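/- arXiv:0811.3649 — 2 statements merged into one kernel-verified Lean document; each statement's English description precedes it below -/
import Mathlib

section
/- For q odd, n odd, and 0 ≤ β ≤ n−1, the double character sum satisfies the duality S(β; n) = q^{β − (n−1)/2} · S(n−1−β; n). -/
open Polynomial
open scoped Classical

/-- The quadratic residue symbol `(B/P)` for `P` a monic irreducible polynomial:
`0` if `P ∣ B`, `1` if `B` is a nonzero square modulo `P`, and `-1` otherwise. -/
noncomputable def legendreSymbol {F : Type*} [Field F] (B P : F[X]) : ℤ :=
  if P ∣ B then 0 else if ∃ C : F[X], P ∣ (C ^ 2 - B) then 1 else -1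

/-- The double character sum
`S(β; n) = Σ_{P monic irreducible, deg P = n} Σ_{B monic, deg B = β} (B/P)`. -/
noncomputable def doubleCharSum (F : Type*) [Field F] (β n : ℕ) : ℤ :=
  ∑ᶠ P ∈ {P : F[X] | P.Monic ∧ Irreducible P ∧ P.natDegree = n},
    ∑ᶠ B ∈ {B : F[X] | B.Monic ∧ B.natDegree = β}, legendreSymbol B P

/-- `π_q(n)`, the number of monic irreducible polynomials of degree `n`. -/
noncomputable def primeCount (F : Type*) [Field F] (n : ℕ) : ℕ :=
  {P : F[X] | P.Monic ∧ Irreducible P ∧ P.natDegree = n}.ncard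

section PolynomialsBelow

variable (F : Type*) [Field F] [Finite F]

/-- The finset of polynomials of degree less than `k` over a finite field. -/
noncomputable def polysBelow (k : ℕ) : Finset F[X] :=
  Set.Finite.toFinset (s := (degreeLT F k : Set F[X]))
    (Set.finite_coe_iff.1 ((degreeLTEquiv F k).toEquiv.finite_iff.2 inferInstance))

variable {F}

lemma mem_polysBelow {k : ℕ} {B : F[X]} : B ∈ polysBelow F k ↔ B.degree < k := by
  rw [polysBelow, Set.Finite.mem_toFinset, SetLike.mem_coe, mem_degreeLT]

lemma mem_polysBelow_iff_coeff {k : ℕ} {B : F[X]} :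
    B ∈ polysBelow F k ↔ ∀ i, k ≤ i → B.coeff i = 0 := by
  rw [mem_polysBelow, degree_lt_iff_coeff_zero]

lemma X_pow_mul_mem_polysBelow {k j : ℕ} {B : F[X]} :
    X ^ k * B ∈ polysBelow F (k + j) ↔ B ∈ polysBelow F j := by
  simp only [mem_polysBelow_iff_coeff]
  constructor
  · intro h i hi
    have := h (i + k) (by omega)
    rwa [coeff_X_pow_mul] at this
  · intro h i hi
    rw [coeff_X_pow_mul', if_pos (by omega)]
    exact h _ (by omega)

lemma polysBelow_mono {k j : ℕ} (h : k ≤ j) : polysBelow F k ⊆ polysBelow F j := by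
  intro B
  simp only [mem_polysBelow_iff_coeff]
  exact fun hB i hi => hB i (h.trans hi)

lemma sum_polysBelow_add {M : Type*} [AddCommMonoid M] (k j : ℕ) (f : F[X] → M) :
    ∑ B ∈ polysBelow F (k + j), f B =
      ∑ E ∈ polysBelow F j, ∑ A ∈ polysBelow F k, f (A + X ^ k * E) := by
  rw [← Finset.sum_product']
  symm
  refine Finset.sum_nbij (fun p => p.2 + X ^ k * p.1) ?_ ?_ ?_ (fun _ _ => rfl)
  · rintro ⟨E, A⟩ h
    obtain ⟨hE, hA⟩ := Finset.mem_product.1 h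
    have h1 := mem_polysBelow_iff_coeff.1 (polysBelow_mono (Nat.le_add_right k j) hA)
    have h2 := mem_polysBelow_iff_coeff.1 ((X_pow_mul_mem_polysBelow (k := k)).2 hE)
    refine mem_polysBelow_iff_coeff.2 fun i hi => ?_
    simp only [coeff_add]
    rw [h1 i hi, h2 i hi, add_zero]
  · rintro ⟨E, A⟩ h ⟨E', A'⟩ h' heq
    obtain ⟨hE, hA⟩ := Finset.mem_product.1 (Finset.mem_coe.1 h)
    obtain ⟨hE', hA'⟩ := Finset.mem_product.1 (Finset.mem_coe.1 h')
    simp only at heq hE hA hE' hA'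
    rw [mem_polysBelow, ← degree_X_pow (R := F) k] at hA hA'
    have key := div_modByMonic_unique E A (monic_X_pow k) ⟨rfl, hA⟩
    have key' := div_modByMonic_unique E' A' (monic_X_pow k) ⟨rfl, hA'⟩
    rw [heq] at key
    rw [← key.1, ← key.2, key'.1, key'.2]
  · intro B hB
    have hB' := Finset.mem_coe.1 hB
    have hmod : B %ₘ X ^ k ∈ polysBelow F k := by
      rw [mem_polysBelow, ← degree_X_pow (R := F) k]
      exact degree_modByMonic_lt _ (monic_X_pow k)
    have hdecomp := modByMonic_add_div B (X ^ k : F[X])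
    refine ⟨(B /ₘ X ^ k, B %ₘ X ^ k), ?_, hdecomp⟩
    refine Finset.mem_coe.2 (Finset.mem_product.2 ⟨?_, hmod⟩)
    have h1 := mem_polysBelow_iff_coeff.1 (polysBelow_mono (Nat.le_add_right k j) hmod)
    refine (X_pow_mul_mem_polysBelow (k := k)).1 (mem_polysBelow_iff_coeff.2 fun i hi => ?_)
    have h2 := mem_polysBelow_iff_coeff.1 hB' i hi
    rw [← hdecomp, coeff_add, h1 i hi, zero_add] at h2
    exact h2

lemma polysBelow_zero : polysBelow F 0 = {0} := by
  ext B
  simp [mem_polysBelow, Nat.WithBot.lt_zero_iff]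

lemma sum_polysBelow_one [Fintype F] {M : Type*} [AddCommMonoid M] (f : F[X] → M) :
    ∑ B ∈ polysBelow F 1, f B = ∑ c : F, f (C c) := by
  symm
  refine Finset.sum_nbij (fun c => C c) ?_ ?_ ?_ (fun _ _ => rfl)
  · intro c _
    exact mem_polysBelow.2 (degree_C_le.trans_lt (by norm_num))
  · exact fun _ _ _ _ h => C_injective h
  · intro B hB
    have hB' := mem_polysBelow_iff_coeff.1 (Finset.mem_coe.1 hB)
    refine ⟨B.coeff 0, by simp, ?_⟩
    ext i
    rcases i with _ | i
    · simp
    · simp [hB' (i + 1) (by omega)]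

lemma card_polysBelow [Fintype F] (k : ℕ) : (polysBelow F k).card = Fintype.card F ^ k := by
  induction k with
  | zero => simp [polysBelow_zero]
  | succ k ih =>
    rw [Finset.card_eq_sum_ones, sum_polysBelow_add, sum_polysBelow_one]
    simp [ih, pow_succ, mul_comm]

lemma finsum_monic_natDegree_eq {M : Type*} [AddCommMonoid M] (k : ℕ) (f : F[X] → M) :
    ∑ᶠ B ∈ {B : F[X] | B.Monic ∧ B.natDegree = k}, f B =
      ∑ A ∈ polysBelow F k, f (A + X ^ k) := by
  have himage : {B : F[X] | B.Monic ∧ B.natDegree = k} =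
      ((polysBelow F k).image (· + X ^ k) : Finset F[X]) := by
    ext B
    simp only [Set.mem_ofPred_eq, Finset.coe_image, Set.mem_image, Finset.mem_coe]
    constructor
    · rintro ⟨hB, rfl⟩
      refine ⟨B - X ^ B.natDegree, mem_polysBelow_iff_coeff.2 fun i hi => ?_, by simp⟩
      rw [coeff_sub, coeff_X_pow]
      split_ifs with h
      · rw [h, hB.coeff_natDegree, sub_self]
      · rw [coeff_eq_zero_of_natDegree_lt (by omega), sub_zero]
    · rintro ⟨A, hA, rfl⟩
      rw [mem_polysBelow] at hA
      rw [add_comm]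
      refine ⟨monic_X_pow_add hA, ?_⟩
      rw [natDegree_add_eq_left_of_degree_lt (by rwa [degree_X_pow]), natDegree_X_pow]
  rw [himage, finsum_mem_coe_finset, Finset.sum_image]
  exact fun _ _ _ _ h => add_right_cancel h

end PolynomialsBelow

section ResidueFunctional

variable {F : Type*} [Field F] [Fintype F] {P : F[X]}

/-- The linear functional on `F[X] / (P)` reading off the coefficient of `X ^ (deg P - 1)` of the
reduced representative. -/
noncomputable def topCoeff (hP : P.Monic) : AdjoinRoot P →ₗ[F] F :=
  lcoeff F (P.natDegree - 1) ∘ₗ AdjoinRoot.modByMonicHom hP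

lemma topCoeff_mk (hP : P.Monic) {B : F[X]} (hB : B ∈ polysBelow F P.natDegree) :
    topCoeff hP (AdjoinRoot.mk P B) = B.coeff (P.natDegree - 1) := by
  rw [mem_polysBelow, ← degree_eq_natDegree hP.ne_zero] at hB
  simp [topCoeff, AdjoinRoot.modByMonicHom_mk, (modByMonic_eq_self_iff hP).2 hB]

lemma sum_adjoinRoot [Fintype (AdjoinRoot P)] (hP : P.Monic) {M : Type*} [AddCommMonoid M]
    (f : AdjoinRoot P → M) :
    ∑ x, f x = ∑ B ∈ polysBelow F P.natDegree, f (AdjoinRoot.mk P B) := by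
  symm
  have hmem (B : F[X]) : B ∈ polysBelow F P.natDegree ↔ B %ₘ P = B := by
    rw [mem_polysBelow, ← degree_eq_natDegree hP.ne_zero, modByMonic_eq_self_iff hP]
  refine Finset.sum_nbij (fun B => AdjoinRoot.mk P B) (by simp) ?_ ?_ (fun _ _ => rfl)
  · intro A hA B hB h
    have := congrArg (AdjoinRoot.modByMonicHom hP) h
    simp only [AdjoinRoot.modByMonicHom_mk] at this
    rwa [(hmem A).1 hA, (hmem B).1 hB] at this
  · intro x _
    obtain ⟨B, rfl⟩ := AdjoinRoot.mk_surjective x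
    refine ⟨B %ₘ P, ?_, ?_⟩
    · rw [Finset.mem_coe, mem_polysBelow, ← degree_eq_natDegree hP.ne_zero]
      exact degree_modByMonic_lt _ hP
    · simpa [AdjoinRoot.modByMonicHom_mk] using
        AdjoinRoot.mk_leftInverse hP (AdjoinRoot.mk P B)

lemma sum_addChar_topCoeff_mul (hP : P.Monic) {ψ : AddChar F ℂ} (hψ : ψ.IsPrimitive) {k : ℕ}
    (hk : k ≤ P.natDegree) {E : F[X]} (hE : E ∈ polysBelow F P.natDegree) :
    ∑ A ∈ polysBelow F k, ψ (topCoeff hP (AdjoinRoot.mk P (A * E))) =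
      if E ∈ polysBelow F (P.natDegree - k) then (Fintype.card F : ℂ) ^ k else 0 := by
  split_ifs with hEk
  · have (A) (hA : A ∈ polysBelow F k) : ψ (topCoeff hP (AdjoinRoot.mk P (A * E))) = 1 := by
      have hzero : (A * E) ∈ polysBelow F (P.natDegree - 1) := by
        by_cases hA0 : A = 0
        · simp [hA0, mem_polysBelow]
        by_cases hE0 : E = 0
        · simp [hE0, mem_polysBelow]
        rw [mem_polysBelow, degree_eq_natDegree (by simp [hA0, hE0]), natDegree_mul hA0 hE0]
        rw [mem_polysBelow, degree_eq_natDegree hA0] at hA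
        rw [mem_polysBelow, degree_eq_natDegree hE0] at hEk
        norm_cast at hA hEk ⊢
        omega
      rw [topCoeff_mk hP (polysBelow_mono (Nat.sub_le _ _) hzero),
        mem_polysBelow_iff_coeff.1 hzero _ le_rfl, AddChar.map_zero_eq_one]
    rw [Finset.sum_congr rfl this]
    simp [card_polysBelow]
  · have hE0 : E ≠ 0 := by
      rintro rfl
      simp [mem_polysBelow] at hEk
    rw [mem_polysBelow, degree_eq_natDegree hE0] at hE hEk
    norm_cast at hE hEk
    set d := E.natDegree with hd
    have hlc : E.leadingCoeff ≠ 0 := leadingCoeff_ne_zero.2 hE0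
    obtain ⟨s, hs⟩ := AddChar.ne_one_iff.1 (hψ hlc)
    rw [AddChar.mulShift_apply] at hs
    set A₀ : F[X] := C s * X ^ (P.natDegree - 1 - d) with hA₀
    have hA₀k : A₀ ∈ polysBelow F k := by
      rw [mem_polysBelow]
      refine (degree_C_mul_X_pow_le _ _).trans_lt ?_
      norm_cast
      omega
    have hval : ψ (topCoeff hP (AdjoinRoot.mk P (A₀ * E))) ≠ 1 := by
      have hmem : A₀ * E ∈ polysBelow F P.natDegree := by
        rw [mem_polysBelow, degree_mul]
        refine (add_le_add (degree_C_mul_X_pow_le _ _) degree_le_natDegree).trans_lt ?_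
        norm_cast
        omega
      rw [topCoeff_mk hP hmem, hA₀, mul_assoc, coeff_C_mul, coeff_X_pow_mul',
        if_pos (by omega), show P.natDegree - 1 - (P.natDegree - 1 - d) = d by omega]
      rwa [mul_comm] at hs
    refine eq_zero_of_mul_eq_self_left hval ?_
    rw [Finset.mul_sum]
    have hclosed {A B : F[X]} (hA : A ∈ polysBelow F k) (hB : B ∈ polysBelow F k) :
        A + B ∈ polysBelow F k ∧ A - B ∈ polysBelow F k := by
      rw [mem_polysBelow_iff_coeff] at hA hB
      constructor <;> refine mem_polysBelow_iff_coeff.2 fun i hi => ?_ <;>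
        simp [hA i hi, hB i hi]
    refine Finset.sum_nbij' (A₀ + ·) (· - A₀) (fun A hA => (hclosed hA₀k hA).1)
      (fun A hA => (hclosed hA hA₀k).2) (by simp) (by simp) fun A _ => ?_
    rw [add_mul, map_add, map_add, AddChar.map_add_eq_mul]

/-- The half-dimensional isotropic subspace of polynomials of degree less than `m` reduces the
quadratic exponential sum over `F[X] / (P)` to one over `F`. -/
lemma sum_addChar_topCoeff_sq (hP : P.Monic) [Fintype (AdjoinRoot P)] (h2 : (2 : F) ≠ 0)
    {ψ : AddChar F ℂ} (hψ : ψ.IsPrimitive) {m : ℕ} (hm : P.natDegree = 2 * m + 1) :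
    ∑ x, ψ (topCoeff hP (x ^ 2)) = (Fintype.card F : ℂ) ^ m * ∑ c : F, ψ (c ^ 2) := by
  rw [sum_adjoinRoot hP, hm, show 2 * m + 1 = m + (m + 1) by ring, sum_polysBelow_add]
  have hinner (E) (hE : E ∈ polysBelow F (m + 1)) :
      ∑ A ∈ polysBelow F m, ψ (topCoeff hP (AdjoinRoot.mk P (A + X ^ m * E) ^ 2)) =
        if E ∈ polysBelow F 1 then
          (Fintype.card F : ℂ) ^ m * ψ (topCoeff hP (AdjoinRoot.mk P (X ^ m * E) ^ 2))
        else 0 := by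
    have hC2 (j : ℕ) (B : F[X]) : C 2 * B ∈ polysBelow F j ↔ B ∈ polysBelow F j := by
      rw [mem_polysBelow, mem_polysBelow, degree_C_mul h2]
    have hsplit (A) (hA : A ∈ polysBelow F m) :
        ψ (topCoeff hP (AdjoinRoot.mk P (A + X ^ m * E) ^ 2)) =
          ψ (topCoeff hP (AdjoinRoot.mk P (A * (C 2 * (X ^ m * E))))) *
            ψ (topCoeff hP (AdjoinRoot.mk P (X ^ m * E) ^ 2)) := by
      have hA2 : A ^ 2 ∈ polysBelow F (2 * m) := by
        by_cases hA0 : A = 0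
        · simp [hA0, mem_polysBelow_iff_coeff]
        rw [mem_polysBelow, degree_eq_natDegree (pow_ne_zero 2 hA0), natDegree_pow]
        rw [mem_polysBelow, degree_eq_natDegree hA0] at hA
        norm_cast at hA ⊢
        omega
      have hzero : topCoeff hP (AdjoinRoot.mk P (A ^ 2)) = 0 := by
        rw [topCoeff_mk hP (polysBelow_mono (by omega) hA2),
          mem_polysBelow_iff_coeff.1 hA2 _ (by omega)]
      rw [← AddChar.map_add_eq_mul, ← map_pow, ← map_pow,
        show (A + X ^ m * E) ^ 2 = A ^ 2 + (A * (C 2 * (X ^ m * E)) + (X ^ m * E) ^ 2) by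
          rw [show (C 2 : F[X]) = 2 from rfl]; ring,
        map_add, map_add, hzero, zero_add, map_add, map_add]
    rw [Finset.sum_congr rfl hsplit, ← Finset.sum_mul,
      sum_addChar_topCoeff_mul hP hψ (by omega)
        ((hC2 _ _).2 (by
          rw [show P.natDegree = m + (m + 1) by omega]
          exact X_pow_mul_mem_polysBelow.2 hE)),
      show P.natDegree - m = m + 1 by omega, ite_mul, zero_mul]
    exact if_congr ((hC2 _ _).trans X_pow_mul_mem_polysBelow) rfl rfl
  rw [Finset.sum_congr rfl hinner, ← Finset.sum_filter, Finset.filter_mem_eq_inter,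
    Finset.inter_eq_right.2 (polysBelow_mono (by omega)), sum_polysBelow_one, Finset.mul_sum]
  refine Finset.sum_congr rfl fun c _ => ?_
  have hpow : (X ^ m * C c) ^ 2 = (C (c ^ 2) * X ^ (2 * m) : F[X]) := by
    rw [C_pow]; ring
  rw [← map_pow, hpow, topCoeff_mk hP, hm]
  · rw [coeff_C_mul_X_pow, if_pos (by omega)]
  · rw [mem_polysBelow, hm]
    refine (degree_C_mul_X_pow_le _ _).trans_lt ?_
    norm_cast
    omega

end ResidueFunctional

section QuadraticCharacter

/-- The complex-valued quadratic character of a finite field. -/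
noncomputable def complexQuadraticChar (K : Type*) [Field K] [Fintype K] : MulChar K ℂ :=
  (quadraticChar K).ringHomComp (Int.castRingHom ℂ)

lemma complexQuadraticChar_apply {K : Type*} [Field K] [Fintype K] (x : K) :
    complexQuadraticChar K x = (quadraticChar K x : ℂ) := rfl

lemma complexQuadraticChar_ne_one {K : Type*} [Field K] [Fintype K] (hK : ringChar K ≠ 2) :
    complexQuadraticChar K ≠ 1 :=
  (MulChar.ringHomComp_ne_one_iff (RingHom.injective_int (Int.castRingHom ℂ))).2
    (quadraticChar_ne_one hK)

lemma sum_addChar_sq_eq_gaussSum {K : Type*} [Field K] [Fintype K] (hK : ringChar K ≠ 2)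
    {ψ : AddChar K ℂ} (hψ : ψ ≠ 1) :
    ∑ x, ψ (x ^ 2) = gaussSum (complexQuadraticChar K) ψ := by
  have hfiber (y : K) : ∑ x with x ^ 2 = y, ψ (x ^ 2) =
      complexQuadraticChar K y * ψ y + ψ y := by
    rw [Finset.sum_congr rfl (g := fun _ => ψ y) (fun x hx => by
      rw [(Finset.mem_filter.1 hx).2]), Finset.sum_const, nsmul_eq_mul,
      complexQuadraticChar_apply, ← add_one_mul]
    congr 1
    have := quadraticChar_card_sqrts hK y
    rw [Set.toFinset_ofPred] at this
    exact_mod_cast this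
  rw [← Finset.sum_fiberwise Finset.univ (fun x : K => x ^ 2), Finset.sum_congr rfl
    (fun y _ => hfiber y), Finset.sum_add_distrib, AddChar.sum_eq_zero_of_ne_one hψ, add_zero]
  rfl

lemma sum_complexQuadraticChar_mul_addChar {K : Type*} [Field K] [Fintype K]
    (hK : ringChar K ≠ 2) (ψ : AddChar K ℂ) (b : K) :
    ∑ x, complexQuadraticChar K x * ψ (x * b) =
      complexQuadraticChar K b * gaussSum (complexQuadraticChar K) ψ := by
  by_cases hb : b = 0
  · simp [hb, MulChar.map_zero, MulChar.sum_eq_zero_of_ne_one (complexQuadraticChar_ne_one hK)]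
  · rw [← gaussSum_mulShift _ ψ (Units.mk0 b hb), ← mul_assoc, Units.val_mk0, ← map_mul,
      complexQuadraticChar_apply (b * b), ← sq, quadraticChar_sq_one' hb, Int.cast_one, one_mul]
    simp [gaussSum, AddChar.mulShift_apply, mul_comm b]

lemma quadraticChar_algebraMap_of_odd_finrank {F K : Type*} [Field F] [Fintype F] [Field K]
    [Fintype K] [Algebra F K] (hodd : Odd (Module.finrank F K)) (c : F) :
    quadraticChar K (algebraMap F K c) = quadraticChar F c := by
  by_cases hc : c = 0
  · rw [hc, map_zero, quadraticChar_zero, quadraticChar_zero]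
  have hc' : algebraMap F K c ≠ 0 := by simpa using hc
  have hsq : IsSquare (algebraMap F K c) ↔ IsSquare c := by
    refine ⟨fun h => ?_, fun h => h.map (algebraMap F K)⟩
    have hnorm := h.map (Algebra.norm F)
    obtain ⟨r, hr⟩ := hodd
    rw [Algebra.norm_algebraMap, hr] at hnorm
    obtain ⟨y, hy⟩ := hnorm
    refine ⟨y / c ^ r, ?_⟩
    field_simp
    linear_combination hy
  by_cases h : IsSquare c
  · rw [(quadraticChar_one_iff_isSquare hc).2 h, (quadraticChar_one_iff_isSquare hc').2 (hsq.2 h)]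
  · rw [quadraticChar_neg_one_iff_not_isSquare.2 h,
      quadraticChar_neg_one_iff_not_isSquare.2 (hsq.not.2 h)]

lemma legendreSymbol_eq_quadraticChar {F : Type*} [Field F] (P : F[X]) [Fact (Irreducible P)]
    [Fintype (AdjoinRoot P)] (B : F[X]) :
    legendreSymbol B P = quadraticChar (AdjoinRoot P) (AdjoinRoot.mk P B) := by
  have hsq : (∃ C : F[X], P ∣ C ^ 2 - B) ↔ IsSquare (AdjoinRoot.mk P B) := by
    simp_rw [isSquare_iff_exists_sq, AdjoinRoot.mk_surjective.exists, ← map_pow,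
      eq_comm (a := AdjoinRoot.mk P B), AdjoinRoot.mk_eq_mk]
  unfold legendreSymbol
  split_ifs with h0 h1
  · rw [AdjoinRoot.mk_eq_zero.2 h0, quadraticChar_zero]
  · exact ((quadraticChar_one_iff_isSquare (AdjoinRoot.mk_eq_zero.not.2 h0)).2 (hsq.1 h1)).symm
  · exact (quadraticChar_neg_one_iff_not_isSquare.2 (hsq.not.1 h1)).symm

end QuadraticCharacter

section FunctionalEquation

lemma finrank_adjoinRoot {F : Type*} [Field F] {P : F[X]} (hP : P.Monic) :
    Module.finrank F (AdjoinRoot P) = P.natDegree := by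
  rw [(AdjoinRoot.powerBasis' hP).finrank, AdjoinRoot.powerBasis'_dim]

variable {F : Type*} [Field F] [Fintype F]

lemma sum_polysBelow_C_mul {M : Type*} [AddCommMonoid M] {c : F} (hc : c ≠ 0) (k : ℕ)
    (f : F[X] → M) :
    ∑ A ∈ polysBelow F k, f (C c * A) = ∑ A ∈ polysBelow F k, f A := by
  have hmem {d : F} (hd : d ≠ 0) (A : F[X]) (hA : A ∈ polysBelow F k) :
      C d * A ∈ polysBelow F k := by
    rwa [mem_polysBelow, degree_C_mul hd, ← mem_polysBelow]
  refine Finset.sum_nbij' (C c * ·) (C c⁻¹ * ·) (hmem hc) (hmem (inv_ne_zero hc)) ?_ ?_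
    (fun _ _ => rfl) <;>
  · intro A _
    simp [← mul_assoc, ← C_mul, hc]

variable {P : F[X]} [Fact (Irreducible P)] [Fintype (AdjoinRoot P)]

lemma complexQuadraticChar_mk_C (hP : P.Monic) (hodd : Odd P.natDegree) (c : F) :
    complexQuadraticChar (AdjoinRoot P) (AdjoinRoot.mk P (C c)) = complexQuadraticChar F c := by
  rw [complexQuadraticChar_apply, complexQuadraticChar_apply,
    ← quadraticChar_algebraMap_of_odd_finrank (K := AdjoinRoot P)
      (by rwa [finrank_adjoinRoot hP]) c]
  rfl

/-- Summing the quadratic character modulo `P` over polynomials with prescribed coefficient of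
`X ^ k` and degree at most `k`. -/
lemma sum_complexQuadraticChar_add_X_pow_mul_C (hF : ringChar F ≠ 2) (hP : P.Monic)
    (hodd : Odd P.natDegree) (k : ℕ) (c : F) :
    ∑ A ∈ polysBelow F k, complexQuadraticChar _ (AdjoinRoot.mk P (A + X ^ k * C c)) =
      complexQuadraticChar F c *
        ∑ A ∈ polysBelow F k, complexQuadraticChar _ (AdjoinRoot.mk P (A + X ^ k)) := by
  by_cases hc : c = 0
  · obtain ⟨d, hd⟩ := quadraticChar_exists_neg_one hF
    have hd0 : d ≠ 0 := by
      rintro rfl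
      simp at hd
    have hneg := sum_polysBelow_C_mul hd0 k
      fun A => complexQuadraticChar _ (AdjoinRoot.mk P A)
    simp_rw [map_mul, complexQuadraticChar_mk_C hP hodd, complexQuadraticChar_apply d, hd,
      ← Finset.mul_sum] at hneg
    push_cast at hneg
    simp only [hc, map_zero, mul_zero, add_zero, MulChar.map_zero, zero_mul]
    linear_combination (-1 / 2 : ℂ) * hneg
  · rw [← sum_polysBelow_C_mul hc, Finset.mul_sum]
    refine Finset.sum_congr rfl fun A _ => ?_
    rw [← complexQuadraticChar_mk_C hP hodd, ← map_mul, ← map_mul]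
    congr 2
    ring

/-- The functional equation of `L(u, χ_P)` for `P` of odd degree, coefficient by coefficient. -/
lemma sum_complexQuadraticChar_functional_equation (hF : ringChar F ≠ 2) (hP : P.Monic) {m : ℕ}
    (hm : P.natDegree = 2 * m + 1) {k : ℕ} (hk : k ≤ 2 * m) :
    (Fintype.card F : ℂ) ^ m *
        ∑ A ∈ polysBelow F k, complexQuadraticChar _ (AdjoinRoot.mk P (A + X ^ k)) =
      (Fintype.card F : ℂ) ^ k *
        ∑ A ∈ polysBelow F (2 * m - k),
          complexQuadraticChar _ (AdjoinRoot.mk P (A + X ^ (2 * m - k))) := by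
  have hodd : Odd P.natDegree := ⟨m, hm⟩
  have hK : ringChar (AdjoinRoot P) ≠ 2 := by rwa [← Algebra.ringChar_eq F (AdjoinRoot P)]
  set ψ := AddChar.FiniteField.primitiveChar_to_Complex F
  have hψ : ψ.IsPrimitive := AddChar.FiniteField.primitiveChar_to_Complex_isPrimitive F
  have hψ1 : ψ ≠ 1 := by simpa using hψ one_ne_zero
  set Ψ : AddChar (AdjoinRoot P) ℂ := ψ.compAddMonoidHom (topCoeff hP).toAddMonoidHom
  have hΨ (x) : Ψ x = ψ (topCoeff hP x) := rfl
  have hX (c : F) : topCoeff hP (AdjoinRoot.mk P (C c * X ^ (2 * m))) = c := by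
    rw [topCoeff_mk hP, hm, coeff_C_mul_X_pow, if_pos (by omega)]
    rw [mem_polysBelow, hm]
    refine (degree_C_mul_X_pow_le _ _).trans_lt ?_
    norm_cast
    omega
  have hΨ1 : Ψ ≠ 1 := by
    obtain ⟨c, hc⟩ := AddChar.ne_one_iff.1 hψ1
    exact AddChar.ne_one_iff.2 ⟨_, by rwa [hΨ, hX]⟩
  have h2 : (2 : F) ≠ 0 := Ring.two_ne_zero hF
  set τ := gaussSum (complexQuadraticChar F) ψ with hτ
  have hτ0 : τ ≠ 0 := gaussSum_ne_zero_of_nontrivial (by simp) (complexQuadraticChar_ne_one hF) hψ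
  have hG : gaussSum (complexQuadraticChar (AdjoinRoot P)) Ψ = (Fintype.card F : ℂ) ^ m * τ := by
    rw [← sum_addChar_sq_eq_gaussSum hK hΨ1, hτ, ← sum_addChar_sq_eq_gaussSum hF hψ1]
    exact sum_addChar_topCoeff_sq hP h2 hψ hm
  have hinner (B) (hB : B ∈ polysBelow F P.natDegree) :
      ∑ A ∈ polysBelow F k, complexQuadraticChar _ (AdjoinRoot.mk P B) *
          Ψ (AdjoinRoot.mk P B * AdjoinRoot.mk P (A + X ^ k)) =
        if B ∈ polysBelow F (P.natDegree - k) then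
          (Fintype.card F : ℂ) ^ k * (complexQuadraticChar _ (AdjoinRoot.mk P B) *
            Ψ (AdjoinRoot.mk P (X ^ k * B)))
        else 0 := by
    have hsplit (A : F[X]) : complexQuadraticChar _ (AdjoinRoot.mk P B) *
        Ψ (AdjoinRoot.mk P B * AdjoinRoot.mk P (A + X ^ k)) =
          ψ (topCoeff hP (AdjoinRoot.mk P (A * B))) *
            (complexQuadraticChar _ (AdjoinRoot.mk P B) * Ψ (AdjoinRoot.mk P (X ^ k * B))) := by
      rw [← hΨ, mul_left_comm, ← AddChar.map_add_eq_mul, ← map_add, ← map_mul]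
      congr 3
      ring
    rw [Finset.sum_congr rfl fun A _ => hsplit A, ← Finset.sum_mul,
      sum_addChar_topCoeff_mul hP hψ (by omega) hB, ite_mul, zero_mul]
  have hcoeff (c : F) (A) (hA : A ∈ polysBelow F (2 * m - k)) :
      Ψ (AdjoinRoot.mk P (X ^ k * (A + X ^ (2 * m - k) * C c))) = ψ c := by
    have hA' : X ^ k * A ∈ polysBelow F (2 * m) := by
      rw [show 2 * m = k + (2 * m - k) by omega]
      exact X_pow_mul_mem_polysBelow.2 hA
    have hsplit : X ^ k * (A + X ^ (2 * m - k) * C c) = X ^ k * A + C c * X ^ (2 * m) := by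
      rw [show (X : F[X]) ^ (2 * m) = X ^ k * X ^ (2 * m - k) by
        rw [← pow_add, Nat.add_sub_cancel' hk]]
      ring
    rw [hsplit, hΨ, map_add, map_add, hX, topCoeff_mk hP (polysBelow_mono (by omega) hA'),
      mem_polysBelow_iff_coeff.1 hA' _ (by omega), zero_add]
  have key : (∑ A ∈ polysBelow F k, complexQuadraticChar _ (AdjoinRoot.mk P (A + X ^ k))) *
      ((Fintype.card F : ℂ) ^ m * τ) = (Fintype.card F : ℂ) ^ k * (τ *
        ∑ A ∈ polysBelow F (2 * m - k),
          complexQuadraticChar _ (AdjoinRoot.mk P (A + X ^ (2 * m - k)))) := by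
    rw [← hG, Finset.sum_mul]
    simp_rw [← sum_complexQuadraticChar_mul_addChar hK Ψ, sum_adjoinRoot hP]
    rw [Finset.sum_comm, Finset.sum_congr rfl hinner, ← Finset.sum_filter,
      Finset.filter_mem_eq_inter, Finset.inter_eq_right.2 (polysBelow_mono (Nat.sub_le _ _)),
      ← Finset.mul_sum, show P.natDegree - k = 2 * m - k + 1 by omega, sum_polysBelow_add,
      sum_polysBelow_one, hτ, gaussSum, Finset.sum_mul]
    congr 1
    refine Finset.sum_congr rfl fun c _ => ?_
    rw [Finset.sum_congr rfl fun A hA => by rw [hcoeff c A hA], ← Finset.sum_mul,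
      sum_complexQuadraticChar_add_X_pow_mul_C hF hP hodd]
    ring
  exact mul_right_cancel₀ hτ0 (by linear_combination key)

end FunctionalEquation

section LegendreSymbol

variable {F : Type*} [Field F] [Fintype F]

lemma finsum_legendreSymbol_functional_equation (hF : ringChar F ≠ 2) {P : F[X]} (hP : P.Monic)
    (hirr : Irreducible P) {m : ℕ} (hm : P.natDegree = 2 * m + 1) {k : ℕ} (hk : k ≤ 2 * m) :
    (Fintype.card F : ℤ) ^ m *
        ∑ᶠ B ∈ {B : F[X] | B.Monic ∧ B.natDegree = k}, legendreSymbol B P =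
      (Fintype.card F : ℤ) ^ k *
        ∑ᶠ B ∈ {B : F[X] | B.Monic ∧ B.natDegree = 2 * m - k}, legendreSymbol B P := by
  have : Fact (Irreducible P) := ⟨hirr⟩
  have : Module.Finite F (AdjoinRoot P) := (AdjoinRoot.powerBasis' hP).finite
  have : Finite (AdjoinRoot P) := Module.finite_of_finite F
  let _ : Fintype (AdjoinRoot P) := Fintype.ofFinite _
  have h := sum_complexQuadraticChar_functional_equation hF hP hm hk
  simp_rw [complexQuadraticChar_apply, ← legendreSymbol_eq_quadraticChar] at h
  simp_rw [finsum_monic_natDegree_eq]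
  exact_mod_cast h

end LegendreSymbol

/-- For `q` odd, `n` odd, and `0 ≤ β ≤ n-1`, the duality
`S(β; n) = q^{β - (n-1)/2} S(n-1-β; n)` holds. -/
theorem doubleCharSum_duality_odd (F : Type*) [Field F] [Fintype F]
    (hq : Odd (Fintype.card F)) (n : ℕ) (hodd : Odd n) (β : ℕ) (hβ : β ≤ n - 1) :
    ((doubleCharSum F β n : ℤ) : ℚ) =
      (Fintype.card F : ℚ) ^ ((β : ℤ) - ((n - 1) / 2 : ℕ)) *
        ((doubleCharSum F (n - 1 - β) n : ℤ) : ℚ) := by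
  obtain ⟨m, rfl⟩ := hodd
  have hF : ringChar F ≠ 2 := fun h =>
    Nat.not_even_iff_odd.2 hq (Nat.even_iff.2 (FiniteField.even_card_of_char_two h))
  have hq0 : (Fintype.card F : ℚ) ≠ 0 := by simp
  rw [Nat.add_sub_cancel] at hβ ⊢
  have key : (Fintype.card F : ℤ) ^ m * doubleCharSum F β (2 * m + 1) =
      (Fintype.card F : ℤ) ^ β * doubleCharSum F (2 * m - β) (2 * m + 1) := by
    unfold doubleCharSum
    rw [mul_finsum_mem, mul_finsum_mem]
    exact finsum_mem_congr rfl fun P hP =>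
      finsum_legendreSymbol_functional_equation hF hP.1 hP.2.1 hP.2.2 hβ
  have keyℚ : (Fintype.card F : ℚ) ^ m * (doubleCharSum F β (2 * m + 1) : ℚ) =
      (Fintype.card F : ℚ) ^ β * (doubleCharSum F (2 * m - β) (2 * m + 1) : ℚ) := by
    exact_mod_cast key
  rw [Nat.mul_div_cancel_left m two_pos, zpow_sub₀ hq0, zpow_natCast, zpow_natCast,
    div_mul_eq_mul_div, eq_div_iff (pow_ne_zero m hq0), mul_comm, keyℚ]
end

section
/- For q odd and β < n, S(β; n) = η_β·π_q(n)·q^{β/2} + O((β/n)·q^{n/2 + β}), where η_β = 1 if β is even and 0 if β is odd. -/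
open Polynomial
open scoped Classical

theorem finite_monic_natDegree_eq (F : Type*) [Field F] [Finite F] (d : ℕ) :
    {B : F[X] | B.Monic ∧ B.natDegree = d}.Finite :=
  Set.finite_coe_iff.1 <| Finite.of_equiv _
    ((monicEquivDegreeLT (R := F) d).trans (degreeLTEquiv F d).toEquiv).symm

theorem ncard_monic_natDegree_eq (F : Type*) [Field F] [Fintype F] (d : ℕ) :
    {B : F[X] | B.Monic ∧ B.natDegree = d}.ncard = Fintype.card F ^ d := by
  rw [← Nat.card_coe_set_eq]
  exact (Nat.card_congr ((monicEquivDegreeLT (R := F) d).trans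
    (degreeLTEquiv F d).toEquiv)).trans (by simp)

theorem finite_monic_irreducible_natDegree_eq (F : Type*) [Field F] [Finite F] (d : ℕ) :
    {P : F[X] | P.Monic ∧ Irreducible P ∧ P.natDegree = d}.Finite :=
  (finite_monic_natDegree_eq F d).subset fun _ hP => ⟨hP.1, hP.2.2⟩

/-- The finset of monic polynomials of degree `d` over a finite field. -/
noncomputable def monicsOfDegree (F : Type*) [Field F] [Finite F] (d : ℕ) : Finset F[X] :=
  (finite_monic_natDegree_eq F d).toFinset

/-- The finset of monic irreducible polynomials of degree `d` over a finite field. -/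
noncomputable def primesOfDegree (F : Type*) [Field F] [Finite F] (d : ℕ) : Finset F[X] :=
  (finite_monic_irreducible_natDegree_eq F d).toFinset

theorem mem_monicsOfDegree {F : Type*} [Field F] [Finite F] {d : ℕ} {B : F[X]} :
    B ∈ monicsOfDegree F d ↔ B.Monic ∧ B.natDegree = d := by
  simp [monicsOfDegree]

theorem mem_primesOfDegree {F : Type*} [Field F] [Finite F] {d : ℕ} {P : F[X]} :
    P ∈ primesOfDegree F d ↔ P.Monic ∧ Irreducible P ∧ P.natDegree = d := by
  simp [primesOfDegree]

theorem card_monicsOfDegree (F : Type*) [Field F] [Fintype F] (d : ℕ) :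
    (monicsOfDegree F d).card = Fintype.card F ^ d := by
  rw [← ncard_monic_natDegree_eq, monicsOfDegree, Set.ncard_eq_toFinset_card _ (finite_monic_natDegree_eq F d)]

theorem card_primesOfDegree (F : Type*) [Field F] [Finite F] (d : ℕ) :
    (primesOfDegree F d).card = primeCount F d := by
  rw [primeCount, primesOfDegree, Set.ncard_eq_toFinset_card _ (finite_monic_irreducible_natDegree_eq F d)]

theorem doubleCharSum_eq_sum (F : Type*) [Field F] [Finite F] (β n : ℕ) :
    doubleCharSum F β n =
      ∑ B ∈ monicsOfDegree F β, ∑ P ∈ primesOfDegree F n, legendreSymbol B P := by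
  rw [doubleCharSum, finsum_mem_eq_finite_toFinset_sum _
    (finite_monic_irreducible_natDegree_eq F n), Finset.sum_comm]
  exact Finset.sum_congr rfl fun P _ =>
    finsum_mem_eq_finite_toFinset_sum _ (finite_monic_natDegree_eq F β)

theorem mul_card_le_natDegree_of_forall_dvd {F : Type*} [Field F] {n : ℕ} {S : Finset F[X]}
    {H : F[X]} (hH : H ≠ 0)
    (hS : ∀ P ∈ S, (P.Monic ∧ Irreducible P ∧ P.natDegree = n) ∧ P ∣ H) :
    n * S.card ≤ H.natDegree := by
  have hdvd : ∏ P ∈ S, P ∣ H := by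
    refine Finset.prod_dvd_of_coprime (fun P hP R hR hne => ?_) fun P hP => (hS P hP).2
    obtain ⟨⟨hPm, hPi, -⟩, -⟩ := hS P hP
    obtain ⟨⟨hRm, hRi, -⟩, -⟩ := hS R hR
    refine (hPi.coprime_iff_not_dvd).2 fun h => hne ?_
    exact eq_of_monic_of_associated hPm hRm (hPi.associated_of_dvd hRi h)
  have := natDegree_le_of_dvd hdvd hH
  rw [natDegree_prod_of_monic _ _ fun P hP => (hS P hP).1.1,
    Finset.sum_congr rfl fun P hP => (hS P hP).1.2.2] at this
  simpa [mul_comm] using this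

theorem mul_card_primesOfDegree_le (F : Type*) [Field F] [Fintype F] {n : ℕ} (hn : n ≠ 0) :
    n * (primesOfDegree F n).card ≤ Fintype.card F ^ n := by
  have h1 : 1 < Fintype.card F := Fintype.one_lt_card
  rw [← FiniteField.X_pow_card_pow_sub_X_natDegree_eq F hn h1]
  refine mul_card_le_natDegree_of_forall_dvd
    (FiniteField.X_pow_card_pow_sub_X_ne_zero F hn h1) fun P hP => ?_
  rw [mem_primesOfDegree] at hP
  refine ⟨hP, ?_⟩
  rw [← Nat.card_eq_fintype_card]
  exact hP.2.1.natDegree_dvd_iff_dvd_X_pow_card_pow_sub_X.1 hP.2.2.dvd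

theorem card_pow_le_mul_card_primesOfDegree_add (F : Type*) [Field F] [Fintype F] {n : ℕ}
    (hn : n ≠ 0) :
    Fintype.card F ^ n ≤
      n * (primesOfDegree F n).card + Fintype.card F * Fintype.card F ^ (n / 2) := by
  obtain ⟨p, hp⟩ := CharP.exists F
  have : Fact p.Prime := ⟨CharP.char_is_prime F p⟩
  have : NeZero n := ⟨hn⟩
  have hq : 1 < Fintype.card F := Fintype.one_lt_card
  set q := Fintype.card F with hqdef
  set E := FiniteField.Extension F p n
  have : Fintype E := Fintype.ofFinite E
  have hE : Fintype.card E = q ^ n := by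
    rw [← Nat.card_eq_fintype_card, FiniteField.natCard_extension, Nat.card_eq_fintype_card]
  have hcover : (Finset.univ : Finset E) ⊆
      ((primesOfDegree F n).biUnion fun P => (P.aroots E).toFinset) ∪
      ((Finset.Icc 1 (n / 2)).biUnion fun d =>
        ((X ^ q ^ d - X : F[X]).aroots E).toFinset) := by
    intro x _
    have hx : IsIntegral F x := IsIntegral.of_finite F x
    have hirr := minpoly.irreducible hx
    have hdvd : (minpoly F x).natDegree ∣ n := by
      have := minpoly.degree_dvd hx
      rwa [FiniteField.finrank_extension] at this
    have hpos : 0 < (minpoly F x).natDegree := minpoly.natDegree_pos hx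
    rw [Finset.mem_union, Finset.mem_biUnion, Finset.mem_biUnion]
    by_cases hd : (minpoly F x).natDegree = n
    · refine Or.inl ⟨minpoly F x, mem_primesOfDegree.2 ⟨minpoly.monic hx, hirr, hd⟩, ?_⟩
      simp [minpoly.ne_zero hx]
    · refine Or.inr ⟨(minpoly F x).natDegree, Finset.mem_Icc.2 ⟨hpos, ?_⟩, ?_⟩
      · obtain ⟨k, hk⟩ := hdvd
        rw [Nat.le_div_iff_mul_le two_pos]
        have : 2 ≤ k := by
          rcases k with _ | _ | k <;> simp_all
        calc _ ≤ (minpoly F x).natDegree * k := Nat.mul_le_mul_left _ this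
          _ = n := hk.symm
      · have h := hirr.natDegree_dvd_iff_dvd_X_pow_card_pow_sub_X.1 dvd_rfl
        rw [Nat.card_eq_fintype_card, ← hqdef] at h
        rw [Multiset.mem_toFinset, mem_aroots]
        refine ⟨FiniteField.X_pow_card_pow_sub_X_ne_zero F hpos.ne' hq, ?_⟩
        exact aeval_eq_zero_of_dvd_aeval_eq_zero h (minpoly.aeval F x)
  have hroots : ∀ P : F[X], (P.aroots E).toFinset.card ≤ P.natDegree := fun P =>
    (Multiset.toFinset_card_le _).trans <| (card_roots' _).trans (by rw [natDegree_map])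
  calc q ^ n = (Finset.univ : Finset E).card := by rw [Finset.card_univ, hE]
    _ ≤ _ := Finset.card_le_card hcover
    _ ≤ _ := Finset.card_union_le _ _
    _ ≤ _ := add_le_add
      (Finset.card_biUnion_le_card_mul _ _ n fun P hP =>
        (hroots P).trans (mem_primesOfDegree.1 hP).2.2.le)
      (Finset.card_biUnion_le.trans <| Finset.sum_le_sum fun d hd => (hroots _).trans
        (FiniteField.X_pow_card_pow_sub_X_natDegree_eq F
          (Nat.one_le_iff_ne_zero.1 (Finset.mem_Icc.1 hd).1) hq).le)
    _ ≤ _ := add_le_add (mul_comm _ _).le <| by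
      rw [← pow_succ']
      exact (Nat.geomSum_lt hq fun k hk => Nat.lt_succ_of_le (Finset.mem_Icc.1 hk).2).le

theorem dvd_pow_half_sub_of_legendreSymbol_eq {F : Type*} [Field F] [Fintype F]
    (hq : Odd (Fintype.card F)) {B P : F[X]} (hP : Irreducible P) {ε : ℤ} (hε : ε ≠ 0)
    (h : legendreSymbol B P = ε) :
    P ∣ B ^ (Fintype.card F ^ P.natDegree / 2) - (ε : F[X]) := by
  have : Fact (Irreducible P) := ⟨hP⟩
  have hfin : Module.Finite F (AdjoinRoot P) := (AdjoinRoot.powerBasis hP.ne_zero).finite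
  have : Finite (AdjoinRoot P) := Module.finite_of_finite F
  have : Fintype (AdjoinRoot P) := Fintype.ofFinite _
  have hcard : Fintype.card (AdjoinRoot P) = Fintype.card F ^ P.natDegree := by
    rw [Module.card_eq_pow_finrank (K := F), (AdjoinRoot.powerBasis hP.ne_zero).finrank,
      AdjoinRoot.powerBasis_dim]
  have hchar : ringChar (AdjoinRoot P) ≠ 2 := by
    rw [ne_eq, FiniteField.even_card_iff_char_two, hcard, ← Nat.even_iff, Nat.not_even_iff_odd]
    exact hq.pow
  have hB : ¬ P ∣ B := fun hd => hε (by rw [← h, legendreSymbol, if_pos hd])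
  have hB' : AdjoinRoot.mk P B ≠ 0 := by rwa [ne_eq, AdjoinRoot.mk_eq_zero]
  rw [← AdjoinRoot.mk_eq_zero, map_sub, map_pow, map_intCast, sub_eq_zero, ← hcard, ← h,
    legendreSymbol, if_neg hB]
  have hsq : (∃ C : F[X], P ∣ C ^ 2 - B) ↔ IsSquare (AdjoinRoot.mk P B) := by
    simp_rw [isSquare_iff_exists_sq, ← AdjoinRoot.mk_eq_zero, map_sub, map_pow, sub_eq_zero]
    exact ⟨fun ⟨C, hC⟩ => ⟨_, hC.symm⟩, fun ⟨c, hc⟩ =>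
      (AdjoinRoot.mk_surjective c).imp fun C hC => by rw [hC, hc]⟩
  have hiff := FiniteField.isSquare_iff hchar hB'
  split_ifs with hs
  · simpa using hiff.1 (hsq.1 hs)
  · have := (FiniteField.pow_dichotomy hchar hB').resolve_left fun h1 => hs (hsq.2 (hiff.2 h1))
    simpa using this

theorem eq_zero_of_eval_X_pow_eq_zero {R : Type*} [Field R] {t : ℕ} {G : R[X][X]}
    (hG : ∀ j, (G.coeff j).degree < t) (h : G.eval (X ^ t) = 0) : G = 0 := by
  have key : ∀ G : R[X][X], (∀ j, (G.coeff j).degree < t) → G.eval (X ^ t) = 0 →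
      G.coeff 0 = 0 ∧ G.divX.eval (X ^ t) = 0 := fun G hG h => by
    rw [← divX_mul_X_add G, eval_add, eval_mul, eval_X, eval_C] at h
    have h0 : G.coeff 0 = 0 := by
      refine eq_zero_of_dvd_of_degree_lt (p := X ^ t) ?_ (by simpa using hG 0)
      rw [eq_neg_of_add_eq_zero_right h]
      exact (Dvd.intro_left _ rfl).neg_right
    rw [h0, add_zero] at h
    exact ⟨h0, (mul_eq_zero.1 h).resolve_right (pow_ne_zero _ X_ne_zero)⟩
  ext1 j
  rw [coeff_zero]
  induction j generalizing G with
  | zero => exact (key G hG h).1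
  | succ j ih =>
    rw [← coeff_divX]
    exact ih (fun k => by rw [coeff_divX]; exact hG _) (key G hG h).2

theorem natDegree_coeff_mul_le {R : Type*} [Semiring R] {U V : R[X][X]} {a b : ℕ}
    (hU : ∀ j, (U.coeff j).natDegree ≤ a) (hV : ∀ j, (V.coeff j).natDegree ≤ b) (j : ℕ) :
    ((U * V).coeff j).natDegree ≤ a + b := by
  rw [coeff_mul]
  exact natDegree_sum_le_of_forall_le _ _ fun i _ => natDegree_mul_le_of_le (hU _) (hV _)

theorem isSquare_of_sq_eq_C_mul {R : Type*} [Field R] {B : R[X]} {U V M : R[X][X]}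
    (hM : M.Monic) (hV : V ≠ 0) (h : U ^ 2 = C B * M * V ^ 2) : IsSquare B := by
  have hlc := congrArg leadingCoeff h
  rw [leadingCoeff_mul, leadingCoeff_mul, leadingCoeff_C, hM.leadingCoeff, leadingCoeff_pow,
    leadingCoeff_pow, mul_one] at hlc
  have hV' : V.leadingCoeff ≠ 0 := leadingCoeff_ne_zero.2 hV
  obtain ⟨W, hW⟩ := (UniqueFactorizationMonoid.pow_dvd_pow_iff_dvd two_ne_zero).1
    (Dvd.intro_left _ hlc.symm : V.leadingCoeff ^ 2 ∣ U.leadingCoeff ^ 2)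
  refine ⟨W, mul_right_cancel₀ (pow_ne_zero 2 hV') ?_⟩
  rw [← hlc, hW]
  ring

theorem expand_card_pow {F : Type*} [Field F] [Fintype F] (k : ℕ) (f : F[X]) :
    expand F (Fintype.card F ^ k) f = f ^ Fintype.card F ^ k := by
  induction k with
  | zero => simp
  | succ k ih => rw [pow_succ, mul_comm, expand_mul, ih, map_pow, FiniteField.expand_card,
      ← pow_mul]

/-- If `B` is not a square then a combination `u(x, x ^ t) + B ^ ((t + 1) / 2) v(x, x ^ t)` of
bivariate polynomials of small degree in `x` vanishes only trivially. -/
theorem eq_zero_of_eval_add_pow_mul_eval_eq_zero {F : Type*} [Field F] [Fintype F] {B : F[X]}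
    (hB : B.Monic) (hsq : ¬ IsSquare B) {k a : ℕ} (ht : Odd (Fintype.card F ^ k))
    (ha : 2 * a + B.natDegree < Fintype.card F ^ k) {U V : F[X][X]}
    (hU : ∀ j, (U.coeff j).natDegree ≤ a) (hV : ∀ j, (V.coeff j).natDegree ≤ a)
    (h : U.eval (X ^ Fintype.card F ^ k) +
      B ^ ((Fintype.card F ^ k + 1) / 2) * V.eval (X ^ Fintype.card F ^ k) = 0) :
    U = 0 ∧ V = 0 := by
  set t := Fintype.card F ^ k with htdef
  set M : F[X][X] := B.map C
  have hM : M.Monic := hB.map C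
  have hMcoeff : ∀ j, (M.coeff j).natDegree ≤ 0 := fun j => by simp [M]
  have hMeval : M.eval (X ^ t) = B ^ t := by
    rw [eval_map]
    exact (expand_eq_comp_X_pow t).symm.trans (expand_card_pow k B)
  have heven : (t + 1) / 2 * 2 = t + 1 := Nat.div_mul_cancel (ht.add_odd odd_one).two_dvd
  have hzero : U ^ 2 - C B * M * V ^ 2 = 0 := by
    refine eq_zero_of_eval_X_pow_eq_zero (t := t) (fun j => ?_) ?_
    · refine lt_of_le_of_lt degree_le_natDegree (Nat.cast_lt.2 (lt_of_le_of_lt ?_ ha))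
      rw [coeff_sub, sq, sq, mul_assoc, coeff_C_mul]
      refine (natDegree_sub_le _ _).trans (max_le ?_ ?_)
      · have := natDegree_coeff_mul_le hU hU j
        omega
      · have := natDegree_coeff_mul_le hMcoeff (natDegree_coeff_mul_le hV hV) j
        have := natDegree_mul_le (p := B) (q := (M * (V * V)).coeff j)
        omega
    · rw [eval_sub, eval_mul, eval_mul, eval_pow, eval_pow, eval_C, hMeval,
        eq_neg_of_add_eq_zero_left h, neg_sq, mul_pow, ← pow_mul, heven]
      ring
  have hV0 : V = 0 := by
    by_contra hne
    exact hsq (isSquare_of_sq_eq_C_mul hM hne (sub_eq_zero.1 hzero))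
  refine ⟨?_, hV0⟩
  simpa [hV0] using hzero

/-- The linear map `(u_j)_j ↦ ∑ j, u_j(X ^ s) X ^ j`. -/
noncomputable def expandSum (F : Type*) [Field F] (s A J : ℕ) :
    (Fin J → degreeLT F A) →ₗ[F] F[X] :=
  ∑ j : Fin J, LinearMap.mulRight F (X ^ (j : ℕ)) ∘ₗ (expand F s).toLinearMap ∘ₗ
    (degreeLT F A).subtype ∘ₗ LinearMap.proj j

theorem expandSum_apply {F : Type*} [Field F] {s A J : ℕ} (c : Fin J → degreeLT F A) :
    expandSum F s A J c = ∑ j, expand F s (c j : F[X]) * X ^ (j : ℕ) := by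
  simp [expandSum]

theorem natDegree_le_of_mem_degreeLT {F : Type*} [Field F] {a : ℕ} {p : F[X]}
    (hp : p ∈ degreeLT F (a + 1)) : p.natDegree ≤ a := by
  rw [degreeLT_succ_eq_degreeLE, mem_degreeLE] at hp
  exact natDegree_le_of_degree_le hp

theorem natDegree_expandSum_le {F : Type*} [Field F] {s a J : ℕ}
    (c : Fin (J + 1) → degreeLT F (a + 1)) :
    (expandSum F s (a + 1) (J + 1) c).natDegree ≤ a * s + J := by
  rw [expandSum_apply]
  refine natDegree_sum_le_of_forall_le _ _ fun j _ => natDegree_mul_le_of_le ?_ ?_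
  · rw [natDegree_expand]
    exact Nat.mul_le_mul_right _ (natDegree_le_of_mem_degreeLT (c j).2)
  · exact (natDegree_X_pow_le _).trans (Nat.lt_succ_iff.1 j.2)

theorem finrank_degreeLT (F : Type*) [Field F] (A : ℕ) :
    Module.finrank F (degreeLT F A) = A := by
  rw [(degreeLTEquiv F A).finrank_eq, Module.finrank_fin_fun]

theorem exists_expandSum_add_mul_eq_zero {F : Type*} [Field F] {s a J : ℕ} (G : F[X])
    (h : G.natDegree + a * s + J + 1 < 2 * ((J + 1) * (a + 1))) :
    ∃ c d : Fin (J + 1) → degreeLT F (a + 1), (c ≠ 0 ∨ d ≠ 0) ∧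
      expandSum F s (a + 1) (J + 1) c + G * expandSum F s (a + 1) (J + 1) d = 0 := by
  have : ∀ A, FiniteDimensional F (degreeLT F A) := fun A =>
    Module.Finite.equiv (degreeLTEquiv F A).symm
  set T := expandSum F s (a + 1) (J + 1) with hT
  set L := T.coprod (LinearMap.mulLeft F G ∘ₗ T) with hL
  have hmem : ∀ x, L x ∈ degreeLT F (G.natDegree + (a * s + J) + 1) := fun x => by
    rw [degreeLT_succ_eq_degreeLE, mem_degreeLE]
    refine degree_le_of_natDegree_le ?_
    simp only [hL, LinearMap.coprod_apply, LinearMap.comp_apply, LinearMap.mulLeft_apply]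
    refine (natDegree_add_le _ _).trans (max_le ?_ ?_)
    · exact (natDegree_expandSum_le _).trans (Nat.le_add_left _ _)
    · exact natDegree_mul_le_of_le le_rfl (natDegree_expandSum_le _)
  have hker := LinearMap.ker_ne_bot_of_finrank_lt (f := L.codRestrict _ hmem) (by
    simp only [finrank_degreeLT, Module.finrank_prod, Module.finrank_pi_fintype,
      Finset.sum_const, Finset.card_univ, Fintype.card_fin, smul_eq_mul]
    omega)
  obtain ⟨⟨c, d⟩, hx, hne⟩ := Submodule.exists_mem_ne_zero_of_ne_bot hker
  refine ⟨c, d, ?_, ?_⟩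
  · by_contra! hcd
    exact hne (by rw [hcd.1, hcd.2]; rfl)
  · simpa [hL] using hx

/-- The bivariate polynomial `∑ j, u_j(x) y ^ j` attached to a family of polynomials `u_j`. -/
noncomputable def bivariate {F : Type*} [Field F] {A J : ℕ} (c : Fin J → degreeLT F A) :
    F[X][X] :=
  ∑ j, C (c j : F[X]) * X ^ (j : ℕ)

theorem coeff_bivariate {F : Type*} [Field F] {A J : ℕ} (c : Fin J → degreeLT F A) (i : Fin J) :
    (bivariate c).coeff i = c i := by
  rw [bivariate, finsetSum_coeff, Finset.sum_eq_single i]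
  · simp
  · intro j _ hj
    rw [coeff_C_mul_X_pow, if_neg fun h => hj (Fin.ext h.symm)]
  · simp

theorem natDegree_coeff_bivariate_le {F : Type*} [Field F] {a J : ℕ}
    (c : Fin J → degreeLT F (a + 1)) (i : ℕ) : ((bivariate c).coeff i).natDegree ≤ a := by
  rw [bivariate, finsetSum_coeff]
  refine natDegree_sum_le_of_forall_le _ _ fun j _ => ?_
  rw [coeff_C_mul_X_pow]
  split_ifs
  · exact natDegree_le_of_mem_degreeLT (c j).2
  · simp

theorem bivariate_eq_zero_iff {F : Type*} [Field F] {A J : ℕ} {c : Fin J → degreeLT F A} :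
    bivariate c = 0 ↔ c = 0 := by
  refine ⟨fun h => ?_, fun h => by simp [h, bivariate]⟩
  ext1 i
  have := coeff_bivariate c i
  rw [h, coeff_zero] at this
  exact Subtype.ext this.symm

theorem eval_bivariate {F : Type*} [Field F] {A J : ℕ} (c : Fin J → degreeLT F A) (p : F[X]) :
    (bivariate c).eval p = ∑ j, (c j : F[X]) * p ^ (j : ℕ) := by
  simp [bivariate, eval_finsetSum]

theorem natDegree_eval_bivariate_le {F : Type*} [Field F] {a J : ℕ}
    (c : Fin (J + 1) → degreeLT F (a + 1)) (t : ℕ) :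
    ((bivariate c).eval (X ^ t)).natDegree ≤ a + t * J := by
  rw [eval_bivariate]
  refine natDegree_sum_le_of_forall_le _ _ fun j _ => natDegree_mul_le_of_le
    (natDegree_le_of_mem_degreeLT (c j).2) ?_
  rw [← pow_mul]
  exact (natDegree_X_pow_le _).trans (Nat.mul_le_mul_left _ (Nat.lt_succ_iff.1 j.2))

theorem map_expand_eval_bivariate {F R : Type*} [Field F] [CommRing R] {A J s t : ℕ}
    (φ : F[X] →+* R) (hφ : φ X ^ (s * t) = φ X) (c : Fin J → degreeLT F A) :
    φ (expand F s ((bivariate c).eval (X ^ t))) = φ (expandSum F s A J c) := by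
  rw [eval_bivariate, expandSum_apply]
  simp only [map_sum, map_mul, map_pow, expand_X]
  exact Finset.sum_congr rfl fun j _ => by rw [← pow_mul (φ X) s t, hφ]

/-- Stepanov's auxiliary polynomial: a nonzero polynomial of degree about `s * t / 2` divisible by
all primes `P` dividing `X ^ (s * t) - X` modulo which `B ^ (s * t / 2)` is the constant `ε`. -/
theorem exists_auxiliary_polynomial {F : Type*} [Field F] [Fintype F]
    (hq : Odd (Fintype.card F)) {B : F[X]} (hB : B.Monic) (hsq : ¬ IsSquare B) (ε : F)
    {i k s t : ℕ} (hs : s = Fintype.card F ^ i) (ht : t = Fintype.card F ^ k) (hst : s ≤ t)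
    (hm : 2 * B.natDegree ≤ s) :
    ∃ H : F[X], H ≠ 0 ∧ 2 * H.natDegree ≤ s * t + 6 * B.natDegree * t ∧
      ∀ P : F[X], Irreducible P → P ∣ B ^ (s * t / 2) - C ε → P ∣ X ^ (s * t) - X → P ∣ H := by
  set m := B.natDegree with hmdef
  have hsodd : Odd s := hs ▸ hq.pow
  have htodd : Odd t := ht ▸ hq.pow
  obtain ⟨r, hr⟩ := hsodd
  obtain ⟨w, hw⟩ := htodd
  set a := r / 2 with ha
  have ha2 : 2 * a ≤ r := by omega
  obtain ⟨c, d, hne, hcd⟩ := exists_expandSum_add_mul_eq_zero (F := F) (s := s) (a := a)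
    (J := r + 2 * m) (C ε * B ^ (r + 1)) (by
      have hG : (C ε * B ^ (r + 1)).natDegree ≤ (r + 1) * m :=
        (natDegree_C_mul_le _ _).trans natDegree_pow_le
      have : m * r ≤ m * (4 * a + 1) := Nat.mul_le_mul_left _ (by omega)
      rw [hr]
      nlinarith)
  set H := (bivariate c).eval (X ^ t) + B ^ (w + 1) * (bivariate d).eval (X ^ t) with hH
  have hw' : (t + 1) / 2 = w + 1 := by omega
  refine ⟨H, fun h0 => ?_, ?_, fun P hP hPB hPX => ?_⟩
  · have := eq_zero_of_eval_add_pow_mul_eval_eq_zero hB hsq (ht ▸ hw ▸ odd_two_mul_add_one w)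
      (a := a) (by rw [← ht, ← hmdef]; omega) (natDegree_coeff_bivariate_le c)
      (natDegree_coeff_bivariate_le d) (by rw [← ht, hw']; exact h0)
    rw [bivariate_eq_zero_iff, bivariate_eq_zero_iff] at this
    exact hne.elim (fun h => h this.1) fun h => h this.2
  · have hdeg : H.natDegree ≤ (w + 1) * m + (a + t * (r + 2 * m)) := by
      refine (natDegree_add_le _ _).trans (max_le ?_ ?_)
      · exact (natDegree_eval_bivariate_le c t).trans (Nat.le_add_left _ _)
      · exact natDegree_mul_le_of_le natDegree_pow_le (natDegree_eval_bivariate_le d t)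
    have : 2 * (w + 1) * m ≤ 2 * t * m := Nat.mul_le_mul_right _ (by omega)
    rw [hr] at hst ⊢
    nlinarith
  · have : Fact (Irreducible P) := ⟨hP⟩
    rw [← AdjoinRoot.mk_eq_zero, map_sub, sub_eq_zero] at hPB hPX
    rw [map_pow] at hPB hPX
    rw [← AdjoinRoot.mk_eq_zero]
    refine eq_zero_of_pow_eq_zero (n := s) ?_
    have hexp : (w + 1) * s = s * t / 2 + (r + 1) := by
      have : s * t = 2 * (2 * r * w + r + w) + 1 := by rw [hr, hw]; ring
      rw [this, hr, Nat.mul_add_div two_pos]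
      ring
    rw [← map_pow, hs, ← expand_card_pow, ← hs, hH, map_add, map_mul, map_add, map_mul,
      map_expand_eval_bivariate _ hPX, map_expand_eval_bivariate _ hPX, map_pow, hs,
      expand_card_pow, ← hs, ← pow_mul, mul_comm s, hexp, pow_add, map_mul, map_pow, hPB,
      ← map_mul, ← map_mul, ← map_add, hcd, map_zero]

theorem legendreSymbol_eq_one_or_neg_one {F : Type*} [Field F] {B P : F[X]} (h : ¬ P ∣ B) :
    legendreSymbol B P = 1 ∨ legendreSymbol B P = -1 := by
  rw [legendreSymbol, if_neg h]
  split_ifs <;> simp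

theorem legendreSymbol_of_isSquare {F : Type*} [Field F] {B P : F[X]} (hB : IsSquare B)
    (h : ¬ P ∣ B) : legendreSymbol B P = 1 := by
  obtain ⟨D, rfl⟩ := hB
  rw [legendreSymbol, if_neg h, if_pos ⟨D, by simp [sq]⟩]

theorem not_dvd_of_mem_primesOfDegree {F : Type*} [Field F] [Finite F] {B P : F[X]} {β n : ℕ}
    (hB : B ∈ monicsOfDegree F β) (hP : P ∈ primesOfDegree F n) (h : β < n) : ¬ P ∣ B := by
  rw [mem_monicsOfDegree] at hB
  rw [mem_primesOfDegree] at hP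
  exact fun hd => absurd (natDegree_le_of_dvd hd hB.1.ne_zero) (by omega)

theorem sum_legendreSymbol_of_isSquare {F : Type*} [Field F] [Finite F] {B : F[X]} {β n : ℕ}
    (hB : B ∈ monicsOfDegree F β) (h : β < n) (hsq : IsSquare B) :
    ∑ P ∈ primesOfDegree F n, legendreSymbol B P = primeCount F n := by
  rw [Finset.sum_congr rfl fun P hP =>
    legendreSymbol_of_isSquare hsq (not_dvd_of_mem_primesOfDegree hB hP h)]
  simp [card_primesOfDegree]

theorem mul_card_filter_legendreSymbol_le {F : Type*} [Field F] [Fintype F]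
    (hq : Odd (Fintype.card F)) {B : F[X]} (hB : B.Monic) (hsq : ¬ IsSquare B) {n : ℕ}
    (hm : 2 * B.natDegree ≤ Fintype.card F ^ (n / 2)) {ε : ℤ} (hε : ε ≠ 0) :
    2 * (n * ((primesOfDegree F n).filter fun P => legendreSymbol B P = ε).card) ≤
      Fintype.card F ^ n + 6 * B.natDegree * Fintype.card F ^ (n - n / 2) := by
  have hst : Fintype.card F ^ (n / 2) * Fintype.card F ^ (n - n / 2) = Fintype.card F ^ n := by
    rw [← pow_add]
    congr 1
    omega
  obtain ⟨H, hH, hdeg, hdvd⟩ := exists_auxiliary_polynomial hq hB hsq (ε : F) (i := n / 2)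
    (k := n - n / 2) rfl rfl (Nat.pow_le_pow_right Fintype.card_pos (by omega)) hm
  rw [hst] at hdeg hdvd
  refine le_trans (Nat.mul_le_mul_left 2 ?_) hdeg
  refine mul_card_le_natDegree_of_forall_dvd hH fun P hP => ?_
  rw [Finset.mem_filter, mem_primesOfDegree] at hP
  obtain ⟨⟨hPm, hPi, hPn⟩, hPε⟩ := hP
  refine ⟨⟨hPm, hPi, hPn⟩, hdvd P hPi ?_ ?_⟩
  · have := dvd_pow_half_sub_of_legendreSymbol_eq hq hPi hε hPε
    rwa [hPn, ← map_intCast (C : F →+* F[X])] at this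
  · rw [← Nat.card_eq_fintype_card]
    exact hPi.natDegree_dvd_iff_dvd_X_pow_card_pow_sub_X.1 hPn.dvd

/-- Weil's bound, up to a constant, for the sum of `(B/P)` over the primes `P` of degree `n`. -/
theorem mul_abs_sum_legendreSymbol_le {F : Type*} [Field F] [Fintype F]
    (hq : Odd (Fintype.card F)) {B : F[X]} {β n : ℕ} (hB : B ∈ monicsOfDegree F β) (h : β < n)
    (hsq : ¬ IsSquare B) :
    n * |∑ P ∈ primesOfDegree F n, legendreSymbol B P| ≤
      7 * β * (Fintype.card F * Fintype.card F ^ (n / 2)) := by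
  have hBm := (mem_monicsOfDegree.1 hB).1
  have hBd := (mem_monicsOfDegree.1 hB).2
  have hβ : 0 < β := by
    rw [Nat.pos_iff_ne_zero]
    rintro rfl
    rw [hBm.natDegree_eq_zero.1 hBd] at hsq
    exact hsq IsSquare.one
  have hor : ∀ P ∈ primesOfDegree F n, legendreSymbol B P = 1 ∨ legendreSymbol B P = -1 :=
    fun P hP => legendreSymbol_eq_one_or_neg_one (not_dvd_of_mem_primesOfDegree hB hP h)
  have hupper := mul_card_primesOfDegree_le F (n := n) (by omega)
  have hlower := card_pow_le_mul_card_primesOfDegree_add F (n := n) (by omega)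
  have hfilter := fun (ε : ℤ) (hε : ε ≠ 0) (hm : 2 * β ≤ Fintype.card F ^ (n / 2)) =>
    mul_card_filter_legendreSymbol_le hq hBm hsq (n := n) (by rwa [hBd]) hε
  rw [hBd] at hfilter
  set q := Fintype.card F
  set s := q ^ (n / 2)
  set t := q ^ (n - n / 2)
  have hst : s * t = q ^ n := by
    rw [← pow_add]
    congr 1
    omega
  have hts : t ≤ q * s := by
    rw [← pow_succ']
    exact Nat.pow_le_pow_right Fintype.card_pos (by omega)
  set a := ((primesOfDegree F n).filter fun P => legendreSymbol B P = 1).card with ha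
  set b := ((primesOfDegree F n).filter fun P => legendreSymbol B P = -1).card with hb
  have hneg : (primesOfDegree F n).filter (fun P => ¬ legendreSymbol B P = 1) =
      (primesOfDegree F n).filter fun P => legendreSymbol B P = -1 :=
    Finset.filter_congr fun P hP => by rcases hor P hP with h | h <;> simp [h]
  have hcard : (primesOfDegree F n).card = a + b := by
    rw [← Finset.card_filter_add_card_filter_not (s := primesOfDegree F n)
      (fun P => legendreSymbol B P = 1), hneg]
  have hsum : ∑ P ∈ primesOfDegree F n, legendreSymbol B P = (a : ℤ) - b := by
    rw [← Finset.sum_filter_add_sum_filter_not _ (fun P => legendreSymbol B P = 1), hneg,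
      Finset.sum_congr rfl fun P hP => (Finset.mem_filter.1 hP).2,
      Finset.sum_congr (g := fun _ => (-1 : ℤ)) rfl fun P hP => (Finset.mem_filter.1 hP).2]
    simp [ha, hb, sub_eq_add_neg]
  rw [hcard] at hupper hlower
  have hβt : β * t ≤ β * (q * s) := Nat.mul_le_mul_left _ hts
  have hβs : q * s ≤ β * (q * s) := Nat.le_mul_of_pos_left _ hβ
  suffices hnat : n * a ≤ n * b + 7 * (β * (q * s)) ∧ n * b ≤ n * a + 7 * (β * (q * s)) by
    rw [hsum, ← Nat.abs_cast n, ← abs_mul, abs_le, ← Nat.cast_pow]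
    zify at hnat
    constructor <;> linarith [hnat.1, hnat.2]
  rcases le_or_gt (2 * β) s with hm | hm
  · have h1 := hfilter 1 one_ne_zero hm
    have h2 := hfilter (-1) (by norm_num) hm
    constructor <;> nlinarith
  · have : s * t ≤ 2 * β * t := Nat.mul_le_mul_right _ hm.le
    constructor <;> nlinarith

theorem card_filter_isSquare_monicsOfDegree (F : Type*) [Field F] [Fintype F] (β : ℕ) :
    ((monicsOfDegree F β).filter IsSquare).card =
      if Even β then Fintype.card F ^ (β / 2) else 0 := by
  split_ifs with hβ
  · rw [← card_monicsOfDegree]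
    symm
    refine Finset.card_bij (fun D _ => D ^ 2) (fun D hD => ?_) (fun D hD E hE hDE => ?_)
      fun B hB => ?_
    · rw [mem_monicsOfDegree] at hD
      rw [Finset.mem_filter, mem_monicsOfDegree]
      refine ⟨⟨hD.1.pow 2, ?_⟩, IsSquare.sq D⟩
      rw [natDegree_pow, hD.2, Nat.mul_div_cancel' hβ.two_dvd]
    · rw [mem_monicsOfDegree] at hD hE
      refine eq_of_monic_of_associated hD.1 hE.1 ?_
      rcases sq_eq_sq_iff_eq_or_eq_neg.1 hDE with h | h
      · rw [h]
      · rw [h]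
        exact Associated.neg_left (Associated.refl E)
    · rw [Finset.mem_filter, mem_monicsOfDegree] at hB
      obtain ⟨⟨hBm, hBd⟩, D, hD⟩ := hB
      have hD2 : D.leadingCoeff * D.leadingCoeff = 1 := by
        rw [← leadingCoeff_mul, ← hD, hBm.leadingCoeff]
      have hD0 : D ≠ 0 := by
        rintro rfl
        simp at hD2
      refine ⟨C D.leadingCoeff * D, mem_monicsOfDegree.2 ⟨?_, ?_⟩, ?_⟩
      · rw [Monic, leadingCoeff_mul, leadingCoeff_C, hD2]
      · rw [natDegree_C_mul (leadingCoeff_ne_zero.2 hD0), ← hBd, hD, natDegree_mul hD0 hD0]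
        omega
      · rw [mul_pow, ← C_pow, sq, hD2, C_1, one_mul, sq, hD]
  · rw [Finset.card_eq_zero, Finset.filter_eq_empty_iff]
    rintro B hB ⟨D, rfl⟩
    rw [mem_monicsOfDegree] at hB
    have hD0 : D ≠ 0 := by
      rintro rfl
      exact hB.1.ne_zero (mul_zero 0)
    exact hβ (hB.2 ▸ ⟨_, natDegree_mul hD0 hD0⟩)

/-- For `q` odd and `β < n`, `S(β; n) = η_β π_q(n) q^{β/2} + O((β/n) q^{n/2+β})`,
where `η_β = 1` for `β` even and `0` for `β` odd. -/
theorem doubleCharSum_estimate (F : Type*) [Field F] [Fintype F]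
    (hq : Odd (Fintype.card F)) :
    ∃ C : ℝ, ∀ n β : ℕ, β < n →
      |((doubleCharSum F β n : ℤ) : ℝ) -
          (if Even β then (primeCount F n : ℝ) * Real.sqrt (Fintype.card F) ^ β else 0)| ≤
        C * ((β : ℝ) / n) * Real.sqrt (Fintype.card F) ^ n * (Fintype.card F : ℝ) ^ β := by
  refine ⟨7 * Fintype.card F, fun n β h => ?_⟩
  have hn : (0 : ℝ) < n := Nat.cast_pos.2 (by omega)
  set r := Real.sqrt (Fintype.card F) with hr
  have hr2 : r ^ 2 = Fintype.card F := Real.sq_sqrt (Nat.cast_nonneg _)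
  have hr1 : 1 ≤ r := Real.one_le_sqrt.2 (by exact_mod_cast Fintype.card_pos)
  have hsquares : ∑ B ∈ (monicsOfDegree F β).filter IsSquare,
      ((∑ P ∈ primesOfDegree F n, legendreSymbol B P : ℤ) : ℝ) =
      if Even β then (primeCount F n : ℝ) * r ^ β else 0 := by
    rw [Finset.sum_congr rfl fun B hB => congrArg (Int.cast (R := ℝ))
      (sum_legendreSymbol_of_isSquare (Finset.mem_filter.1 hB).1 h (Finset.mem_filter.1 hB).2),
      Finset.sum_const, card_filter_isSquare_monicsOfDegree]
    split_ifs with hβ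
    · rw [nsmul_eq_mul, mul_comm, Nat.cast_pow, ← hr2, ← pow_mul,
        Nat.mul_div_cancel' hβ.two_dvd, Int.cast_natCast]
    · simp
  have hnonsq : ∀ B ∈ (monicsOfDegree F β).filter fun B => ¬ IsSquare B,
      |((∑ P ∈ primesOfDegree F n, legendreSymbol B P : ℤ) : ℝ)| ≤
        7 * Fintype.card F * (β / n) * r ^ n := fun B hB => by
    have hb := mul_abs_sum_legendreSymbol_le hq (Finset.mem_filter.1 hB).1 h
      (Finset.mem_filter.1 hB).2
    have hb' : (n : ℝ) * |((∑ P ∈ primesOfDegree F n, legendreSymbol B P : ℤ) : ℝ)| ≤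
        7 * β * (Fintype.card F * (Fintype.card F : ℝ) ^ (n / 2)) := by exact_mod_cast hb
    have hpow : (Fintype.card F : ℝ) ^ (n / 2) ≤ r ^ n := by
      rw [← hr2, ← pow_mul]
      exact pow_le_pow_right₀ hr1 (Nat.mul_div_le n 2)
    rw [← mul_le_mul_iff_right₀ hn]
    calc _ ≤ _ := hb'
      _ ≤ 7 * β * (Fintype.card F * r ^ n) := by gcongr
      _ = _ := by field_simp
  rw [doubleCharSum_eq_sum, Int.cast_sum, ← Finset.sum_filter_add_sum_filter_not _ IsSquare,
    hsquares, add_sub_cancel_left]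
  refine (Finset.abs_sum_le_sum_abs _ _).trans ((Finset.sum_le_card_nsmul _ _ _ hnonsq).trans ?_)
  rw [nsmul_eq_mul, mul_comm]
  refine mul_le_mul_of_nonneg_left ?_ (by positivity)
  rw [← Nat.cast_pow, ← card_monicsOfDegree]
  exact Nat.cast_le.2 (Finset.card_filter_le _ _)
end
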